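/- Let T be an ergodic automorphism of a standard probability space (X,μ) with Kolmogorov entropy h_μ(T) > 0 (possibly infinite), and let {h_n} be a scaling entropy sequence of (X,μ,T). Then liminf_n (h_n / n) > 0. -/

import Mathlib

open MeasureTheory Filter Set
open scoped ENNReal

/-- A semimetric on a set: symmetric, nonnegative, vanishing on the diagonal,
satisfying the triangle inequality. -/
structure IsSemimetric {Y : Type*} (ρ : Y → Y → ℝ) : Prop where
  refl : ∀ x, ρ x x = 0
  symm : ∀ x y, ρ x y = ρ y x
  nonneg : ∀ x y, 0 ≤ ρ x y
  triangle : ∀ x y z, ρ x z ≤ ρ x y + ρ y z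

/-- `ρ` is separable on the set `s`: some countable subset of `s` is `ρ`-dense in `s`. -/
def SeparableWRT {Y : Type*} (ρ : Y → Y → ℝ) (s : Set Y) : Prop :=
  ∃ D : Set Y, D.Countable ∧ D ⊆ s ∧ ∀ x ∈ s, ∀ ε : ℝ, 0 < ε → ∃ y ∈ D, ρ x y < ε

variable {X : Type*} [MeasurableSpace X]

/-- A semimetric is admissible if it is separable on a measurable subset of full measure. -/
def IsAdmissible (μ : Measure X) (ρ : X → X → ℝ) : Prop :=
  ∃ s : Set X, MeasurableSet s ∧ μ sᶜ = 0 ∧ SeparableWRT ρ s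

/-- There is a partition `X₀, X₁, …, X_k` of `X` into measurable pieces with `μ X₀ < ε`
and the `ρ`-diameter of `X_j` (1 ≤ j ≤ k) less than `ε`. -/
def IsEntropyPartition (μ : Measure X) (ρ : X → X → ℝ) (ε : ℝ) (k : ℕ) : Prop :=
  ∃ P : Fin (k + 1) → Set X,
    (∀ j, MeasurableSet (P j)) ∧
    Pairwise (fun i j => Disjoint (P i) (P j)) ∧
    (⋃ j, P j) = Set.univ ∧
    μ (P 0) < ENNReal.ofReal ε ∧
    ∀ j, j ≠ 0 → ∀ x ∈ P j, ∀ y ∈ P j, ρ x y < ε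

open scoped Classical in
/-- The Kolmogorov ε-entropy `ℍ_ε(X, μ, ρ)` of a semimetric triple: `log₂ k` for the least
`k` admitting an entropy partition, and `∞` if there is none. -/
noncomputable def epsEntropy (μ : Measure X) (ρ : X → X → ℝ) (ε : ℝ) : ℝ≥0∞ :=
  if h : ∃ k, IsEntropyPartition μ ρ ε k
  then ENNReal.ofReal (Real.logb 2 (Nat.find h))
  else ⊤

/-- The shift `T^k ρ` of a semimetric by the `k`-th power (k ∈ ℤ) of an automorphism. -/
def shiftSemimetric (T : Equiv.Perm X) (k : ℤ) (ρ : X → X → ℝ) : X → X → ℝ :=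
  fun x y => ρ ((T ^ k) x) ((T ^ k) y)

/-- The average `T^n_av ρ = (1/n) ∑_{k=0}^{n-1} T^k ρ`. -/
noncomputable def avgSemimetric (T : Equiv.Perm X) (ρ : X → X → ℝ) (n : ℕ) : X → X → ℝ :=
  fun x y => (∑ k ∈ Finset.range n, ρ ((T ^ k) x) ((T ^ k) y)) / n

/-- `h` is a scaling sequence for the semimetric `ρ` w.r.t. the automorphism `T`:
`h` is positive, for every `ε > 0` the sequence `ℍ_ε(X, μ, T^n_av ρ)/h_n` has finite limsup,
and for all sufficiently small `ε > 0` it has positive liminf. Sequences are indexed by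
`n = 1, 2, …`. -/
def IsScalingSeq (μ : Measure X) (T : Equiv.Perm X) (ρ : X → X → ℝ) (h : ℕ → ℝ) : Prop :=
  (∀ n, 1 ≤ n → 0 < h n) ∧
  (∀ ε : ℝ, 0 < ε →
    Filter.limsup (fun n : ℕ =>
      epsEntropy μ (avgSemimetric T ρ n) ε / ENNReal.ofReal (h n)) Filter.atTop < ⊤) ∧
  (∃ ε₀ : ℝ, 0 < ε₀ ∧ ∀ ε : ℝ, 0 < ε → ε < ε₀ →
    0 < Filter.liminf (fun n : ℕ =>
      epsEntropy μ (avgSemimetric T ρ n) ε / ENNReal.ofReal (h n)) Filter.atTop)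

/-- `ρ` is (two-sided) generating for `(X, μ, T)`: the shifts `T^k ρ`, `k ∈ ℤ`, separate points
of a subset of full measure. -/
def IsGenerating (μ : Measure X) (T : Equiv.Perm X) (ρ : X → X → ℝ) : Prop :=
  ∃ s : Set X, MeasurableSet s ∧ μ sᶜ = 0 ∧
    ∀ x ∈ s, ∀ y ∈ s, x ≠ y → ∃ k : ℤ, 0 < ρ ((T ^ k) x) ((T ^ k) y)

/-- `h` is a scaling entropy sequence of the system `(X, μ, T)`: it is a scaling sequence for
some summable admissible measurable generating semimetric. -/
def IsScalingEntropySeq (μ : Measure X) (T : Equiv.Perm X) (h : ℕ → ℝ) : Prop :=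
  ∃ ρ : X → X → ℝ, IsSemimetric ρ ∧
    Measurable (fun p : X × X => ρ p.1 p.2) ∧
    MeasureTheory.Integrable (fun p : X × X => ρ p.1 p.2) (μ.prod μ) ∧
    IsAdmissible μ ρ ∧ IsGenerating μ T ρ ∧ IsScalingSeq μ T ρ h

/-- The (Shannon) entropy, base 2, of the countable partition of `X` into the fibers of `f`. -/
noncomputable def partitionEntropy {ι : Type*} [Countable ι] (μ : Measure X) (f : X → ι) :
    ℝ≥0∞ :=
  ∑' i : ι, ENNReal.ofReal (-((μ (f ⁻¹' {i})).toReal * Real.logb 2 (μ (f ⁻¹' {i})).toReal))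

/-- The Kolmogorov (measure-theoretic) entropy of the automorphism `T`: the supremum over all
finite measurable partitions `ξ` of `lim_n H(ξ ∨ T⁻¹ξ ∨ ⋯ ∨ T^{-(n-1)}ξ)/n`. -/
noncomputable def kolmogorovEntropy (μ : Measure X) (T : Equiv.Perm X) : ℝ≥0∞ :=
  ⨆ (m : ℕ) (ξ : X → Fin m) (_ : ∀ i, MeasurableSet (ξ ⁻¹' {i})),
    Filter.limsup (fun n : ℕ =>
      partitionEntropy μ (fun x => fun i : Fin n => ξ ((T ^ (-(i : ℤ))) x)) / (n : ℝ≥0∞))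
      Filter.atTop

/-- The Kushnirenko `A`-entropy of `T` along the sequence `A = {a_n}`: the supremum over all
countable measurable partitions `ξ` of finite entropy of
`limsup_n H(T^{a_1}ξ ∨ ⋯ ∨ T^{a_n}ξ)/n`. -/
noncomputable def kushnirenkoEntropy (μ : Measure X) (T : Equiv.Perm X) (a : ℕ → ℕ) : ℝ≥0∞ :=
  ⨆ (ξ : X → ℕ) (_ : ∀ i, MeasurableSet (ξ ⁻¹' {i})) (_ : partitionEntropy μ ξ < ⊤),
    Filter.limsup (fun n : ℕ =>
      partitionEntropy μ (fun x => fun i : Fin n => ξ ((T ^ (a i)) x)) / (n : ℝ≥0∞))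
      Filter.atTop

/-- The Koopman operator `f ↦ f ∘ T` on `L²(X, μ)` has purely point spectrum: `L²(X, μ)`
possesses an orthonormal (Hilbert) basis consisting of eigenfunctions of `f ↦ f ∘ T`. -/
def HasPurePointSpectrum (μ : Measure X) (T : X → X) : Prop :=
  ∃ (ι : Type) (b : HilbertBasis ι ℂ (MeasureTheory.Lp ℂ 2 μ)),
    ∀ i : ι, ∃ c : ℂ, (fun x => (b i : MeasureTheory.Lp ℂ 2 μ) (T x))
      =ᵐ[μ] fun x => c * (b i : MeasureTheory.Lp ℂ 2 μ) x

/-! ### Sets controlled by the semimetric -/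

/-- `A` is, up to sets of small measure, separated from its complement by `ρ`. -/
def GoodSet (μ : Measure X) (T : Equiv.Perm X) (ρ : X → X → ℝ) (A : Set X) : Prop :=
  MeasurableSet A ∧ ∀ δ : ℝ≥0∞, 0 < δ → ∃ B : Set X, MeasurableSet B ∧ μ B ≤ δ ∧
    ∃ C : ℝ, 0 ≤ C ∧ ∃ F : Finset ℤ, ∀ x y, x ∉ B → y ∉ B → x ∈ A → y ∉ A →
      1 ≤ C * ∑ k ∈ F, ρ ((T ^ k) x) ((T ^ k) y)

lemma sum_shift_mono {T : Equiv.Perm X} {ρ : X → X → ℝ} (hρ : IsSemimetric ρ)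
    {C C' : ℝ} (hC : 0 ≤ C) (hCC : C ≤ C') {F F' : Finset ℤ} (hF : F ⊆ F') (x y : X) :
    C * ∑ k ∈ F, ρ ((T ^ k) x) ((T ^ k) y) ≤ C' * ∑ k ∈ F', ρ ((T ^ k) x) ((T ^ k) y) := by
  have h1 : ∑ k ∈ F, ρ ((T ^ k) x) ((T ^ k) y) ≤ ∑ k ∈ F', ρ ((T ^ k) x) ((T ^ k) y) :=
    Finset.sum_le_sum_of_subset_of_nonneg hF (fun _ _ _ => hρ.nonneg _ _)
  have h0 : 0 ≤ ∑ k ∈ F, ρ ((T ^ k) x) ((T ^ k) y) :=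
    Finset.sum_nonneg (fun _ _ => hρ.nonneg _ _)
  exact mul_le_mul hCC h1 h0 (hC.trans hCC)

lemma goodSet_empty (μ : Measure X) (T : Equiv.Perm X) (ρ : X → X → ℝ) :
    GoodSet μ T ρ ∅ :=
  ⟨MeasurableSet.empty, fun δ _ => ⟨∅, MeasurableSet.empty, by simp, 0, le_rfl, ∅,
    fun x y _ _ hx => absurd hx (by simp)⟩⟩

lemma GoodSet.compl {μ : Measure X} {T : Equiv.Perm X} {ρ : X → X → ℝ} (hρ : IsSemimetric ρ)
    {A : Set X} (hA : GoodSet μ T ρ A) : GoodSet μ T ρ Aᶜ := by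
  refine ⟨hA.1.compl, fun δ hδ => ?_⟩
  obtain ⟨B, hB, hBδ, C, hC, F, h⟩ := hA.2 δ hδ
  refine ⟨B, hB, hBδ, C, hC, F, fun x y hx hy hxA hyA => ?_⟩
  have := h y x hy hx (by simpa using hyA) hxA
  simpa only [hρ.symm] using this.trans_eq (by
    congr 1
    exact Finset.sum_congr rfl (fun k _ => hρ.symm _ _))

lemma GoodSet.iUnion {μ : Measure X} [IsProbabilityMeasure μ] {T : Equiv.Perm X} {ρ : X → X → ℝ}
    (hρ : IsSemimetric ρ)
    {A : ℕ → Set X} (hA : ∀ i, GoodSet μ T ρ (A i)) : GoodSet μ T ρ (⋃ i, A i) := by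
  have hU : MeasurableSet (⋃ i, A i) := MeasurableSet.iUnion fun i => (hA i).1
  refine ⟨hU, fun δ hδ => ?_⟩
  have hδ2 : 0 < δ / 2 := ENNReal.half_pos hδ.ne'
  have htail : ∃ n : ℕ, μ ((⋃ i, A i) \ (⋃ i ∈ Finset.range n, A i)) ≤ δ / 2 := by
    have hanti : Antitone (fun n : ℕ => (⋃ i, A i) \ (⋃ i ∈ Finset.range n, A i)) := by
      intro a b hab x hx
      refine ⟨hx.1, fun hx' => hx.2 ?_⟩
      simp only [Finset.mem_range, mem_iUnion] at hx' ⊢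
      obtain ⟨i, hi, hxi⟩ := hx'
      exact ⟨i, hi.trans_le hab, hxi⟩
    have hmeas : ∀ n : ℕ, NullMeasurableSet ((⋃ i, A i) \ (⋃ i ∈ Finset.range n, A i)) μ :=
      fun n => (hU.diff (Finset.measurableSet_biUnion _ fun i _ => (hA i).1)).nullMeasurableSet
    have ht := tendsto_measure_iInter_atTop hmeas hanti ⟨0, measure_ne_top _ _⟩
    have he : (⋂ n : ℕ, (⋃ i, A i) \ (⋃ i ∈ Finset.range n, A i)) = ∅ := by
      ext x
      simp only [mem_iInter, Set.mem_sdiff, mem_iUnion, Finset.mem_range, mem_empty_iff_false,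
        iff_false, not_forall]
      by_cases hx : ∃ i, x ∈ A i
      · obtain ⟨i, hi⟩ := hx
        exact ⟨i + 1, fun h => h.2 ⟨i, by omega, hi⟩⟩
      · exact ⟨0, fun h => hx h.1⟩
    rw [he, measure_empty] at ht
    exact (ht.eventually (ge_mem_nhds hδ2)).exists
  obtain ⟨n, hn⟩ := htail
  obtain ⟨δ', hδ'pos, hδ'⟩ := ENNReal.exists_pos_sum_of_countable hδ2.ne' ℕ
  choose B hB hBδ C hC F h using fun i => (hA i).2 (δ' i) (by exact_mod_cast hδ'pos i)
  refine ⟨((⋃ i, A i) \ (⋃ i ∈ Finset.range n, A i)) ∪ ⋃ i, B i,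
    (hU.diff (Finset.measurableSet_biUnion _ fun i _ => (hA i).1)).union (MeasurableSet.iUnion hB),
    ?_, ∑ i ∈ Finset.range n, C i, Finset.sum_nonneg fun i _ => hC i,
    (Finset.range n).biUnion F, ?_⟩
  · calc _ ≤ _ := measure_union_le _ _
      _ ≤ δ / 2 + δ / 2 := by
        refine add_le_add hn ((measure_iUnion_le _).trans ?_)
        exact (ENNReal.tsum_le_tsum hBδ).trans hδ'.le
      _ = δ := ENNReal.add_halves δ
  · intro x y hx hy hxA hyA
    have hx1 : x ∈ ⋃ i ∈ Finset.range n, A i := by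
      by_contra hc
      exact hx (Or.inl ⟨hxA, hc⟩)
    simp only [mem_iUnion] at hx1
    obtain ⟨i, hi, hxi⟩ := hx1
    refine (h i x y (fun hc => hx (Or.inr (mem_iUnion.2 ⟨i, hc⟩)))
      (fun hc => hy (Or.inr (mem_iUnion.2 ⟨i, hc⟩))) hxi
      (fun hc => hyA (mem_iUnion.2 ⟨i, hc⟩))).trans ?_
    exact sum_shift_mono hρ (hC i) (Finset.single_le_sum (f := C) (fun i _ => hC i) hi)
      (Finset.subset_biUnion_of_mem F hi) x y

lemma measurable_perm_zpow {T : Equiv.Perm X} (hT : Measurable (⇑T))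
    (hTs : Measurable (⇑T.symm)) (k : ℤ) : Measurable (⇑(T ^ k)) := by
  have hp : ∀ (S : Equiv.Perm X), Measurable (⇑S) → ∀ n : ℕ, Measurable (⇑(S ^ n)) := by
    intro S hS n
    rw [Equiv.Perm.coe_pow]
    exact hS.iterate n
  obtain ⟨n, rfl | rfl⟩ := k.eq_nat_or_neg
  · simpa using hp T hT n
  · have := hp T⁻¹ hTs n
    simpa using this

lemma goodSet_ball {μ : Measure X} [IsProbabilityMeasure μ] {T : Equiv.Perm X} {ρ : X → X → ℝ}
    (hρ : IsSemimetric ρ) (hm : Measurable (fun p : X × X => ρ p.1 p.2))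
    (hT : Measurable (⇑T)) (hTs : Measurable (⇑T.symm)) (d : X) (k : ℤ) (r : ℝ) :
    GoodSet μ T ρ ((fun x => ρ d ((T ^ k) x)) ⁻¹' Iio r) := by
  have hf : Measurable (fun x => ρ d ((T ^ k) x)) :=
    hm.comp (measurable_const.prodMk (measurable_perm_zpow hT hTs k))
  refine ⟨hf measurableSet_Iio, fun δ hδ => ?_⟩
  have htail : ∃ n : ℕ, μ ((fun x => ρ d ((T ^ k) x)) ⁻¹' Ioo (r - 1 / (n + 1)) r) ≤ δ := by
    have hanti : Antitone
        (fun n : ℕ => (fun x => ρ d ((T ^ k) x)) ⁻¹' Ioo (r - 1 / ((n : ℝ) + 1)) r) := by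
      intro a b hab
      refine preimage_mono (Ioo_subset_Ioo_left ?_)
      have := Nat.one_div_le_one_div (α := ℝ) hab
      linarith
    have ht := tendsto_measure_iInter_atTop (μ := μ)
      (fun n => (hf measurableSet_Ioo).nullMeasurableSet) hanti ⟨0, measure_ne_top _ _⟩
    have he : (⋂ n : ℕ, (fun x => ρ d ((T ^ k) x)) ⁻¹' Ioo (r - 1 / ((n : ℝ) + 1)) r) = ∅ := by
      ext x
      simp only [mem_iInter, mem_preimage, mem_Ioo, mem_empty_iff_false, iff_false, not_forall]
      by_cases hx : ρ d ((T ^ k) x) < r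
      · obtain ⟨n, hn⟩ := exists_nat_one_div_lt (sub_pos.2 hx)
        exact ⟨n, fun h => by linarith [h.1]⟩
      · exact ⟨0, fun h => hx h.2⟩
    rw [he, measure_empty] at ht
    exact (ht.eventually (ge_mem_nhds hδ)).exists
  obtain ⟨n, hn⟩ := htail
  refine ⟨_, hf measurableSet_Ioo, hn, (n : ℝ) + 1, by positivity, {k}, ?_⟩
  intro x y hx _ hxA hyA
  simp only [mem_preimage, mem_Ioo, mem_Iio, not_and, not_lt, Finset.sum_singleton] at *
  have h1 : ρ d ((T ^ k) x) ≤ r - 1 / ((n : ℝ) + 1) := by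
    by_contra hc
    exact absurd (hx (not_le.1 hc)) (not_le.2 hxA)
  have h2 := hρ.triangle d ((T ^ k) x) ((T ^ k) y)
  have h3 : 1 / ((n : ℝ) + 1) ≤ ρ ((T ^ k) x) ((T ^ k) y) := by linarith
  rw [div_le_iff₀ (by positivity)] at h3
  linarith

/-- The σ-algebra of good sets. -/
def goodSpace (μ : Measure X) [IsProbabilityMeasure μ] (T : Equiv.Perm X) (ρ : X → X → ℝ)
    (hρ : IsSemimetric ρ) : MeasurableSpace X where
  MeasurableSet' := GoodSet μ T ρ
  measurableSet_empty := goodSet_empty μ T ρ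
  measurableSet_compl _ h := h.compl hρ
  measurableSet_iUnion _ h := GoodSet.iUnion hρ h

lemma goodSet_of_measurable [StandardBorelSpace X] {μ : Measure X} [IsProbabilityMeasure μ]
    {T : Equiv.Perm X} {ρ : X → X → ℝ}
    (hρ : IsSemimetric ρ) (hm : Measurable (fun p : X × X => ρ p.1 p.2))
    (hT : Measurable (⇑T)) (hTs : Measurable (⇑T.symm)) (hmp : MeasurePreserving (⇑T) μ μ)
    (hadm : IsAdmissible μ ρ) (hgen : IsGenerating μ T ρ) {A : Set X} (hA : MeasurableSet A) :
    GoodSet μ T ρ A := by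
  obtain ⟨s, hs, hs0, D, hDc, hDs, hD⟩ := hadm
  obtain ⟨s', hs', hs'0, hsep⟩ := hgen
  have hmpk : ∀ k : ℤ, MeasurePreserving (⇑(T ^ k)) μ μ := by
    have hp : ∀ (S : Equiv.Perm X), MeasurePreserving (⇑S) μ μ → ∀ n : ℕ,
        MeasurePreserving (⇑(S ^ n)) μ μ := by
      intro S hS n
      rw [Equiv.Perm.coe_pow]
      exact hS.iterate n
    intro k
    obtain ⟨n, rfl | rfl⟩ := k.eq_nat_or_neg
    · simpa using hp T hmp n
    · have h1 : MeasurePreserving (⇑T⁻¹) μ μ :=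
        MeasurePreserving.symm (⟨T, hT, hTs⟩ : X ≃ᵐ X) hmp
      simpa using hp T⁻¹ h1 n
  have : Countable D := hDc.to_subtype
  let Φ : X → (D × ℤ → ℝ) := fun x p => ρ p.1 ((T ^ p.2) x)
  have hΦ : Measurable Φ := measurable_pi_iff.2 fun p =>
    hm.comp (measurable_const.prodMk (measurable_perm_zpow hT hTs p.2))
  have hΦg : @Measurable _ _ (goodSpace μ T ρ hρ) _ Φ := by
    refine @measurable_pi_iff _ _ _ (goodSpace μ T ρ hρ) _ _ |>.2 fun p => ?_
    exact @measurable_of_Iio _ _ _ _ _ (goodSpace μ T ρ hρ) _ _ _ _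
      (fun r => goodSet_ball hρ hm hT hTs p.1 p.2 r)
  let S : Set X := s' ∩ ⋂ k : ℤ, (⇑(T ^ k)) ⁻¹' s
  have hS : MeasurableSet S :=
    hs'.inter (MeasurableSet.iInter fun k => measurable_perm_zpow hT hTs k hs)
  have hS0 : μ Sᶜ = 0 := by
    simp only [S, compl_inter, compl_iInter]
    refine measure_union_null hs'0 (measure_iUnion_null fun k => ?_)
    rw [← preimage_compl, (hmpk k).measure_preimage hs.compl.nullMeasurableSet, hs0]
  have hinj : InjOn Φ S := by
    intro x hx y hy hxy
    by_contra hne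
    obtain ⟨k, hk⟩ := hsep x hx.1 y hy.1 hne
    have hxs : (T ^ k) x ∈ s := mem_iInter.1 hx.2 k
    obtain ⟨d, hd, hdx⟩ := hD _ hxs (ρ ((T ^ k) x) ((T ^ k) y) / 2) (by linarith)
    have h1 : ρ d ((T ^ k) x) = ρ d ((T ^ k) y) := congrFun hxy (⟨d, hd⟩, k)
    have h2 := hρ.triangle ((T ^ k) x) d ((T ^ k) y)
    have h3 := hρ.symm ((T ^ k) x) d
    linarith
  have himg : MeasurableSet (Φ '' (A ∩ S)) :=
    (hA.inter hS).image_of_measurable_injOn hΦ (hinj.mono inter_subset_right)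
  have hA' : GoodSet μ T ρ (Φ ⁻¹' (Φ '' (A ∩ S))) := hΦg himg
  have hiff : ∀ x ∈ S, (x ∈ A ↔ x ∈ Φ ⁻¹' (Φ '' (A ∩ S))) := by
    intro x hx
    constructor
    · intro h
      exact ⟨x, ⟨h, hx⟩, rfl⟩
    · rintro ⟨y, ⟨hy, hyS⟩, hyx⟩
      rwa [← hinj hyS hx hyx]
  refine ⟨hA, fun δ hδ => ?_⟩
  obtain ⟨B, hB, hBδ, C, hC, F, h⟩ := hA'.2 δ hδ
  refine ⟨B ∪ Sᶜ, hB.union hS.compl, ?_, C, hC, F, ?_⟩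
  · refine (measure_union_le _ _).trans ?_
    rw [hS0, add_zero]
    exact hBδ
  · intro x y hx hy hxA hyA
    simp only [mem_union, mem_compl_iff, not_or, not_not] at hx hy
    exact h x y hx.1 hy.1 ((hiff x hx.2).1 hxA) (fun hc => hyA ((hiff y hy.2).2 hc))

/-- A finite partition is controlled by `ρ`. -/
lemma good_partition [StandardBorelSpace X] {μ : Measure X} [IsProbabilityMeasure μ]
    {T : Equiv.Perm X} {ρ : X → X → ℝ}
    (hρ : IsSemimetric ρ) (hm : Measurable (fun p : X × X => ρ p.1 p.2))
    (hT : Measurable (⇑T)) (hTs : Measurable (⇑T.symm)) (hmp : MeasurePreserving (⇑T) μ μ)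
    (hadm : IsAdmissible μ ρ) (hgen : IsGenerating μ T ρ) {m : ℕ} (ξ : X → Fin m)
    (hξ : ∀ i, MeasurableSet (ξ ⁻¹' {i})) (δ : ℝ≥0∞) (hδ : 0 < δ) :
    ∃ B : Set X, MeasurableSet B ∧ μ B ≤ δ ∧
    ∃ C : ℝ, 0 ≤ C ∧ ∃ F : Finset ℤ, ∀ x y, x ∉ B → y ∉ B → ξ x ≠ ξ y →
      1 ≤ C * ∑ k ∈ F, ρ ((T ^ k) x) ((T ^ k) y) := by
  obtain ⟨δ', hδ'pos, hδ'⟩ := ENNReal.exists_pos_sum_of_countable hδ.ne' (Fin m)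
  choose B hB hBδ C hC F h using fun i => (goodSet_of_measurable hρ hm hT hTs hmp hadm hgen
    (hξ i)).2 (δ' i) (by exact_mod_cast hδ'pos i)
  refine ⟨⋃ i, B i, MeasurableSet.iUnion hB, (measure_iUnion_le _).trans
    ((ENNReal.tsum_le_tsum hBδ).trans hδ'.le), ∑ i, C i, Finset.sum_nonneg fun i _ => hC i,
    Finset.univ.biUnion F, fun x y hx hy hxy => ?_⟩
  refine (h (ξ x) x y (fun hc => hx (mem_iUnion.2 ⟨_, hc⟩))
      (fun hc => hy (mem_iUnion.2 ⟨_, hc⟩)) rfl (fun hc => hxy (Eq.symm hc))).trans ?_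
  exact sum_shift_mono hρ (hC _) (Finset.single_le_sum (f := C) (fun i _ => hC i)
    (Finset.mem_univ _)) (Finset.subset_biUnion_of_mem F (Finset.mem_univ _)) x y

/-! ### Entropy of finite-valued maps -/

/-- Entropy in nats of a finite-valued map. -/
noncomputable def natEnt {ι : Type*} [Fintype ι] (μ : Measure X) (f : X → ι) : ℝ :=
  ∑ i, Real.negMulLog (μ.real (f ⁻¹' {i}))

lemma gibbs {ι : Type*} [Fintype ι] (p q : ι → ℝ) (hp : ∀ i, 0 ≤ p i) (hp1 : ∑ i, p i = 1)
    (hq : ∀ i, 0 ≤ q i) (hpq : ∀ i, p i ≠ 0 → 0 < q i) (hq1 : ∑ i, q i ≤ 1) :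
    ∑ i, Real.negMulLog (p i) ≤ ∑ i, p i * (-Real.log (q i)) := by
  have h : ∀ i, Real.negMulLog (p i) ≤ p i * (-Real.log (q i)) + (q i - p i) := by
    intro i
    by_cases h0 : p i = 0
    · simp [h0, hq i]
    · have hpi : 0 < p i := lt_of_le_of_ne (hp i) (Ne.symm h0)
      have hqi := hpq i h0
      have h1 := Real.log_le_sub_one_of_pos (div_pos hqi hpi)
      rw [Real.log_div hqi.ne' hpi.ne'] at h1
      have h2 := mul_le_mul_of_nonneg_left h1 hpi.le
      have h3 : p i * (q i / p i - 1) = q i - p i := by field_simp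
      rw [Real.negMulLog]
      linarith
  have := Finset.sum_le_sum fun i (_ : i ∈ Finset.univ) => h i
  rw [Finset.sum_add_distrib, Finset.sum_sub_distrib] at this
  linarith

lemma sum_fiber {ι κ : Type*} [Fintype ι] [Fintype κ] (μ : Measure X) [IsProbabilityMeasure μ]
    (f : X → ι) (g : X → κ) (hg : ∀ j, MeasurableSet (g ⁻¹' {j})) (i : ι) :
    ∑ j, μ.real ((fun x => (f x, g x)) ⁻¹' {(i, j)}) = μ.real (f ⁻¹' {i}) := by
  classical
  have h1 : ∀ j, (fun x => (f x, g x)) ⁻¹' {(i, j)} = f ⁻¹' {i} ∩ g ⁻¹' {j} := by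
    intro j; ext x; simp
  simp only [h1]
  have h2 := sum_measureReal_preimage_singleton (μ := μ.restrict (f ⁻¹' {i}))
    (Finset.univ : Finset κ) (f := g) (fun j _ => hg j)
  simp only [Finset.coe_univ, preimage_univ, measureReal_restrict_apply_univ] at h2
  rw [← h2]
  refine Finset.sum_congr rfl fun j _ => ?_
  rw [measureReal_restrict_apply (hg j), inter_comm]

lemma sum_prob {ι : Type*} [Fintype ι] (μ : Measure X) [IsProbabilityMeasure μ]
    (f : X → ι) (hf : ∀ j, MeasurableSet (f ⁻¹' {j})) : ∑ j, μ.real (f ⁻¹' {j}) = 1 := by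
  have h2 := sum_measureReal_preimage_singleton (μ := μ)
    (Finset.univ : Finset ι) (f := f) (fun j _ => hf j)
  simpa using h2

lemma natEnt_equiv {ι κ : Type*} [Fintype ι] [Fintype κ] (μ : Measure X) (e : ι ≃ κ)
    (f : X → ι) : natEnt μ (fun x => e (f x)) = natEnt μ f := by
  unfold natEnt
  rw [← Equiv.sum_comp e]
  refine Finset.sum_congr rfl fun i _ => ?_
  congr 2
  ext x
  simp

lemma natEnt_comp {ι : Type*} [Fintype ι] (μ : Measure X) (f : X → ι)
    (hf : ∀ j, MeasurableSet (f ⁻¹' {j})) {S : X → X} (hS : MeasurePreserving S μ μ) :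
    natEnt μ (fun x => f (S x)) = natEnt μ f := by
  unfold natEnt
  refine Finset.sum_congr rfl fun i _ => ?_
  congr 1
  exact hS.measureReal_preimage (hf i).nullMeasurableSet

lemma natEnt_nonneg {ι : Type*} [Fintype ι] (μ : Measure X) [IsProbabilityMeasure μ]
    (f : X → ι) : 0 ≤ natEnt μ f :=
  Finset.sum_nonneg fun _ _ => Real.negMulLog_nonneg measureReal_nonneg measureReal_le_one

lemma natEnt_prod {ι κ : Type*} [Fintype ι] [Fintype κ] (μ : Measure X) [IsProbabilityMeasure μ]
    (f : X → ι) (g : X → κ) (hf : ∀ j, MeasurableSet (f ⁻¹' {j}))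
    (hg : ∀ j, MeasurableSet (g ⁻¹' {j})) :
    natEnt μ (fun x => (f x, g x)) ≤ natEnt μ f + natEnt μ g := by
  have hfg : ∀ p : ι × κ, (fun x => (f x, g x)) ⁻¹' {p} = f ⁻¹' {p.1} ∩ g ⁻¹' {p.2} := by
    rintro ⟨i, j⟩; ext x; simp
  have hm : ∀ p : ι × κ, MeasurableSet ((fun x => (f x, g x)) ⁻¹' {p}) := fun p => by
    rw [hfg]; exact (hf _).inter (hg _)
  have hle1 : ∀ p : ι × κ, μ.real ((fun x => (f x, g x)) ⁻¹' {p}) ≤ μ.real (f ⁻¹' {p.1}) :=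
    fun p => by rw [hfg]; exact measureReal_mono inter_subset_left
  have hle2 : ∀ p : ι × κ, μ.real ((fun x => (f x, g x)) ⁻¹' {p}) ≤ μ.real (g ⁻¹' {p.2}) :=
    fun p => by rw [hfg]; exact measureReal_mono inter_subset_right
  have hpos : ∀ p : ι × κ, μ.real ((fun x => (f x, g x)) ⁻¹' {p}) ≠ 0 →
      0 < μ.real (f ⁻¹' {p.1}) ∧ 0 < μ.real (g ⁻¹' {p.2}) := by
    intro p hp
    have h0 : 0 < μ.real ((fun x => (f x, g x)) ⁻¹' {p}) :=
      lt_of_le_of_ne measureReal_nonneg (Ne.symm hp)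
    exact ⟨h0.trans_le (hle1 p), h0.trans_le (hle2 p)⟩
  refine (gibbs _ (fun p => μ.real (f ⁻¹' {p.1}) * μ.real (g ⁻¹' {p.2}))
    (fun _ => measureReal_nonneg) (sum_prob μ _ hm)
    (fun _ => mul_nonneg measureReal_nonneg measureReal_nonneg)
    (fun p hp => mul_pos (hpos p hp).1 (hpos p hp).2) ?_).trans_eq ?_
  · rw [Fintype.sum_prod_type]
    simp only [← Finset.mul_sum, sum_prob μ g hg, mul_one, sum_prob μ f hf, le_refl]
  · have h1 : ∀ p : ι × κ, μ.real ((fun x => (f x, g x)) ⁻¹' {p}) *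
        -Real.log (μ.real (f ⁻¹' {p.1}) * μ.real (g ⁻¹' {p.2})) =
        μ.real ((fun x => (f x, g x)) ⁻¹' {p}) * -Real.log (μ.real (f ⁻¹' {p.1})) +
        μ.real ((fun x => (f x, g x)) ⁻¹' {p}) * -Real.log (μ.real (g ⁻¹' {p.2})) := by
      intro p
      by_cases hp : μ.real ((fun x => (f x, g x)) ⁻¹' {p}) = 0
      · simp [hp]
      · rw [Real.log_mul (hpos p hp).1.ne' (hpos p hp).2.ne']; ring
    simp only [h1]
    rw [Finset.sum_add_distrib]
    congr 1
    · rw [Fintype.sum_prod_type]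
      simp only [← Finset.sum_mul, sum_fiber μ f g hg]
      exact Finset.sum_congr rfl fun i _ => by rw [Real.negMulLog]; ring
    · rw [Fintype.sum_prod_type_right]
      have h2 : ∀ j, ∑ i, μ.real ((fun x => (f x, g x)) ⁻¹' {(i, j)}) = μ.real (g ⁻¹' {j}) := by
        intro j
        rw [← sum_fiber μ g f hf j]
        refine Finset.sum_congr rfl fun i _ => ?_
        congr 1
        ext x
        simp [and_comm]
      simp only [← Finset.sum_mul, h2]
      exact Finset.sum_congr rfl fun i _ => by rw [Real.negMulLog]; ring

/-- The `n`-name of a point. -/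
def nameMap {m : ℕ} (T : Equiv.Perm X) (ξ : X → Fin m) (n : ℕ) (x : X) : Fin n → Fin m :=
  fun i => ξ ((T ^ (i : ℕ)) x)

lemma measurable_perm_pow {T : Equiv.Perm X} (hT : Measurable (⇑T)) (n : ℕ) :
    Measurable (⇑(T ^ n)) := by
  rw [Equiv.Perm.coe_pow]
  exact hT.iterate n

lemma mp_perm_pow {μ : Measure X} {T : Equiv.Perm X} (hT : MeasurePreserving (⇑T) μ μ) (n : ℕ) :
    MeasurePreserving (⇑(T ^ n)) μ μ := by
  rw [Equiv.Perm.coe_pow]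
  exact hT.iterate n

lemma measurable_nameMap {m : ℕ} {T : Equiv.Perm X} (hT : Measurable (⇑T)) {ξ : X → Fin m}
    (hξ : Measurable ξ) (n : ℕ) : Measurable (nameMap T ξ n) :=
  measurable_pi_iff.2 fun i => hξ.comp (measurable_perm_pow hT i)

lemma subadditive_natEnt {m : ℕ} {μ : Measure X} [IsProbabilityMeasure μ] {T : Equiv.Perm X}
    (hT : MeasurePreserving (⇑T) μ μ) {ξ : X → Fin m} (hξ : Measurable ξ) :
    Subadditive (fun n => natEnt μ (nameMap T ξ n)) := by
  intro a b
  have hm := fun n j => measurable_nameMap hT.measurable hξ n (measurableSet_singleton j)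
  have h1 : nameMap T ξ (a + b) =
      fun x => Fin.appendEquiv (α := Fin m) a b (nameMap T ξ a x, nameMap T ξ b ((T ^ a) x)) := by
    funext x i
    refine Fin.addCases (fun i => ?_) (fun i => ?_) i
    · simp [nameMap, Fin.appendEquiv]
    · simp [nameMap, Fin.appendEquiv, add_comm a, pow_add]
  change natEnt μ (nameMap T ξ (a + b)) ≤ natEnt μ (nameMap T ξ a) + natEnt μ (nameMap T ξ b)
  rw [h1, natEnt_equiv, ← natEnt_comp μ (nameMap T ξ b) (hm b) (mp_perm_pow hT a)]
  exact natEnt_prod μ _ _ (hm a)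
    (fun j => (mp_perm_pow hT a).measurable (hm b j))

lemma partitionEntropy_eq {m : ℕ} {μ : Measure X} [IsProbabilityMeasure μ] {T : Equiv.Perm X}
    (hT : MeasurePreserving (⇑T) μ μ) (hTs : Measurable (⇑T.symm))
    {ξ : X → Fin m} (hξ : Measurable ξ) (n : ℕ) :
    partitionEntropy μ (fun x => fun i : Fin n => ξ ((T ^ (-(i : ℤ))) x)) =
      ENNReal.ofReal (natEnt μ (nameMap T ξ n) / Real.log 2) := by
  have hlog : 0 < Real.log 2 := Real.log_pos one_lt_two
  have h1 : natEnt μ (fun x => fun i : Fin n => ξ ((T ^ (-(i : ℤ))) x)) =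
      natEnt μ (nameMap T ξ n) := by
    have hmf : Measurable (fun x => fun i : Fin n => ξ ((T ^ (-(i : ℤ))) x)) :=
      measurable_pi_iff.2 fun i => hξ.comp (measurable_perm_zpow hT.measurable hTs _)
    rw [← natEnt_comp μ _ (fun j => hmf (measurableSet_singleton j)) (mp_perm_pow hT (n - 1)),
      ← natEnt_equiv μ (Equiv.arrowCongr Fin.revPerm (Equiv.refl (Fin m))) (nameMap T ξ n)]
    congr 1
    funext x i
    simp only [Equiv.arrowCongr_apply, nameMap, Function.comp, Equiv.refl_apply,
      Fin.revPerm_symm, Fin.revPerm_apply, Fin.val_rev]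
    congr 1
    rw [← zpow_natCast, ← zpow_natCast, ← Equiv.Perm.mul_apply, ← zpow_add]
    congr 2
    have := i.2
    omega
  rw [← h1, partitionEntropy, tsum_fintype, natEnt, Finset.sum_div,
    ENNReal.ofReal_sum_of_nonneg]
  · refine Finset.sum_congr rfl fun j _ => ?_
    congr 1
    rw [Real.negMulLog, Real.logb, Measure.real]
    ring
  · intro j _
    exact div_nonneg (Real.negMulLog_nonneg measureReal_nonneg measureReal_le_one) hlog.le

/-- Positive Kolmogorov entropy gives a partition with linearly growing entropy. -/
lemma exists_partition {μ : Measure X} [IsProbabilityMeasure μ] {T : Equiv.Perm X}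
    (hT : MeasurePreserving (⇑T) μ μ) (hTs : Measurable (⇑T.symm))
    (hpos : 0 < kolmogorovEntropy μ T) :
    ∃ (m : ℕ) (ξ : X → Fin m) (c : ℝ), Measurable ξ ∧ 0 < c ∧
      ∀ n : ℕ, c * n ≤ natEnt μ (nameMap T ξ n) := by
  rw [kolmogorovEntropy] at hpos
  simp only [lt_iSup_iff] at hpos
  obtain ⟨m, ξ, hξ', hlim⟩ := hpos
  have hξ : Measurable ξ := measurable_to_countable' hξ'
  have hlog : 0 < Real.log 2 := Real.log_pos one_lt_two
  have hsub := subadditive_natEnt hT hξ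
  have hbdd : BddBelow (range fun n : ℕ => natEnt μ (nameMap T ξ n) / n) :=
    ⟨0, by rintro _ ⟨n, rfl⟩; exact div_nonneg (natEnt_nonneg _ _) (Nat.cast_nonneg n)⟩
  have ht := hsub.tendsto_lim hbdd
  have ht2 : Tendsto (fun n : ℕ =>
      partitionEntropy μ (fun x => fun i : Fin n => ξ ((T ^ (-(i : ℤ))) x)) / (n : ℝ≥0∞))
      atTop (nhds (ENNReal.ofReal (hsub.lim / Real.log 2))) := by
    refine (ENNReal.tendsto_ofReal (ht.div_const (Real.log 2))).congr' ?_
    filter_upwards [eventually_gt_atTop 0] with n hn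
    have hn' : (0 : ℝ) < n := by exact_mod_cast hn
    rw [partitionEntropy_eq hT hTs hξ, ← ENNReal.ofReal_natCast, ← ENNReal.ofReal_div_of_pos hn']
    congr 1
    field_simp
  rw [ht2.limsup_eq, ENNReal.ofReal_pos] at hlim
  have hc : 0 < hsub.lim := by
    have := mul_pos hlim hlog
    rwa [div_mul_cancel₀ _ hlog.ne'] at this
  refine ⟨m, ξ, hsub.lim, hξ, hc, fun n => ?_⟩
  rcases Nat.eq_zero_or_pos n with rfl | hn
  · simpa using natEnt_nonneg _ _
  · have := hsub.lim_le_div hbdd hn.ne'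
    rwa [le_div_iff₀ (by exact_mod_cast hn)] at this

/-! ### The coding bound -/

lemma natEnt_le_code {m n k : ℕ} {μ : Measure X} [IsProbabilityMeasure μ]
    (f : X → Fin n → Fin m) (hf : Measurable f) (w : Fin k → Fin n → Fin m) (hk : 0 < k)
    (t : ℝ) (ht : 0 < t) (ht1 : t ≤ 1) (g : X → ℝ) (hg : Integrable g μ)
    (hfg : ∀ x, ∃ j, ((Finset.univ.filter fun i => f x i ≠ w j i).card : ℝ) ≤ g x) :
    natEnt μ f ≤ Real.log k + n * (m * t) + (-Real.log t) * ∫ x, g x ∂μ := by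
  have hk' : (0 : ℝ) < k := by exact_mod_cast hk
  have hZ : 0 < 1 + (m : ℝ) * t := by positivity
  let q : (Fin n → Fin m) → ℝ := fun v =>
    (1 / (k : ℝ)) * ∑ j, ∏ i, ((if v i = w j i then 1 else t) / (1 + (m : ℝ) * t))
  have hterm : ∀ (v : Fin n → Fin m) (j : Fin k),
      0 < ∏ i, ((if v i = w j i then 1 else t) / (1 + (m : ℝ) * t)) := by
    intro v j
    refine Finset.prod_pos fun i _ => div_pos ?_ hZ
    split_ifs
    · exact one_pos
    · exact ht
  have hq : ∀ v, 0 < q v := by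
    intro v
    refine mul_pos (by positivity) (Finset.sum_pos (fun j _ => hterm v j) ⟨⟨0, hk⟩, by simp⟩)
  have hq1 : ∑ v, q v ≤ 1 := by
    simp only [q]
    rw [← Finset.mul_sum, Finset.sum_comm]
    have h1 : ∀ j : Fin k, ∑ v : Fin n → Fin m,
        ∏ i, ((if v i = w j i then 1 else t) / (1 + (m : ℝ) * t)) ≤ 1 := by
      intro j
      rw [← Fintype.piFinset_univ, ← Finset.prod_univ_sum (fun _ : Fin n => Finset.univ)
        (fun i a => (if a = w j i then 1 else t) / (1 + (m : ℝ) * t))]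
      refine Finset.prod_le_one (fun i _ => Finset.sum_nonneg fun a _ => ?_) (fun i _ => ?_)
      · split_ifs <;> positivity
      · rw [← Finset.sum_div, div_le_one hZ]
        calc ∑ a : Fin m, (if a = w j i then (1 : ℝ) else t)
            ≤ ∑ a : Fin m, ((if a = w j i then (1 : ℝ) else 0) + t) := by
              refine Finset.sum_le_sum fun a _ => ?_
              split_ifs <;> linarith
          _ = 1 + m * t := by simp [Finset.sum_add_distrib]
    have h2 := Finset.sum_le_sum fun j (_ : j ∈ Finset.univ) => h1 j
    simp only [Finset.sum_const, Finset.card_univ, Fintype.card_fin, nsmul_eq_mul, mul_one] at h2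
    calc _ ≤ 1 / (k : ℝ) * k := mul_le_mul_of_nonneg_left h2 (by positivity)
      _ = 1 := by field_simp
  have hlogt : 0 ≤ -Real.log t := by
    have := Real.log_nonpos ht.le ht1
    linarith
  have hlogq : ∀ x, -Real.log (q (f x)) ≤
      Real.log k + n * (m * t) + (-Real.log t) * g x := by
    intro x
    obtain ⟨j, hj⟩ := hfg x
    have h1 : (1 / (k : ℝ)) * ∏ i, ((if f x i = w j i then 1 else t) / (1 + (m : ℝ) * t))
        ≤ q (f x) :=
      mul_le_mul_of_nonneg_left (Finset.single_le_sum
        (f := fun j => ∏ i, ((if f x i = w j i then 1 else t) / (1 + (m : ℝ) * t)))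
        (fun j _ => (hterm (f x) j).le) (Finset.mem_univ j)) (by positivity)
    have hne1 : (∏ i, if f x i = w j i then (1 : ℝ) else t) ≠ 0 := by
      refine Finset.prod_ne_zero_iff.2 fun i _ => ?_
      split_ifs
      · exact one_ne_zero
      · exact ht.ne'
    have hne2 : (∏ _i : Fin n, (1 + (m : ℝ) * t)) ≠ 0 :=
      Finset.prod_ne_zero_iff.2 fun i _ => hZ.ne'
    have h2 := Real.log_le_log (mul_pos (by positivity) (hterm (f x) j)) h1
    rw [Real.log_mul (one_div_pos.2 hk').ne' (hterm (f x) j).ne',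
      Real.log_div one_ne_zero hk'.ne', Real.log_one, Finset.prod_div_distrib,
      Real.log_div hne1 hne2, Finset.prod_const, Finset.card_univ, Fintype.card_fin, Real.log_pow,
      Finset.prod_ite, Finset.prod_const_one, one_mul, Finset.prod_const,
      Real.log_pow] at h2
    have h3 : Real.log (1 + (m : ℝ) * t) ≤ m * t := by
      have := Real.log_le_sub_one_of_pos hZ
      linarith
    have h4 : (n : ℝ) * Real.log (1 + (m : ℝ) * t) ≤ n * (m * t) :=
      mul_le_mul_of_nonneg_left h3 (Nat.cast_nonneg n)
    have h5 := mul_le_mul_of_nonneg_left hj hlogt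
    simp only [ne_eq] at h5
    nlinarith
  have hgib := gibbs (fun v => μ.real (f ⁻¹' {v})) q (fun _ => measureReal_nonneg)
    (sum_prob μ f fun j => hf (measurableSet_singleton j)) (fun v => (hq v).le)
    (fun v _ => hq v) hq1
  have hint : ∑ v, μ.real (f ⁻¹' {v}) * (-Real.log (q v)) = ∫ x, -Real.log (q (f x)) ∂μ := by
    have : IsProbabilityMeasure (μ.map f) := Measure.isProbabilityMeasure_map hf.aemeasurable
    rw [← integral_map (φ := f) (f := fun v => -Real.log (q v)) hf.aemeasurable
      (measurable_of_finite _).aestronglyMeasurable,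
      integral_fintype Integrable.of_finite]
    refine Finset.sum_congr rfl fun v _ => ?_
    rw [map_measureReal_apply hf (measurableSet_singleton v), smul_eq_mul]
  have hint2 : Integrable (fun x => -Real.log (q (f x))) μ := by
    have : IsProbabilityMeasure (μ.map f) := Measure.isProbabilityMeasure_map hf.aemeasurable
    have h : Integrable (fun v => -Real.log (q v)) (μ.map f) := Integrable.of_finite
    exact h.comp_measurable hf
  have hmono : ∫ x, -Real.log (q (f x)) ∂μ ≤
      ∫ x, (Real.log k + n * (m * t) + (-Real.log t) * g x) ∂μ :=
    integral_mono hint2 ((integrable_const (Real.log k + n * (m * t))).add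
      (hg.const_mul (-Real.log t))) hlogq
  have hcomp : ∫ x, (Real.log k + n * (m * t) + (-Real.log t) * g x) ∂μ
      = Real.log k + n * (m * t) + (-Real.log t) * ∫ x, g x ∂μ := by
    rw [integral_add (integrable_const _) (hg.const_mul _), integral_const_mul]
    simp
  rw [hcomp] at hmono
  rw [natEnt]
  linarith

lemma card_shift_out (n : ℕ) (k : ℤ) :
    (∑ i ∈ Finset.range n, if (0 ≤ (i : ℤ) + k ∧ (i : ℤ) + k < n) then (0 : ℝ) else 1)
      ≤ k.natAbs := by
  have h1 : (∑ i ∈ Finset.range n, if (0 ≤ (i : ℤ) + k ∧ (i : ℤ) + k < n) then (0 : ℝ) else 1)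
      = (((Finset.range n).filter fun i : ℕ => ¬ (0 ≤ (i : ℤ) + k ∧ (i : ℤ) + k < n)).card : ℝ) := by
    rw [Finset.card_filter]
    push_cast
    refine Finset.sum_congr rfl fun i _ => ?_
    split_ifs <;> simp_all
  rw [h1]
  norm_cast
  rcases le_total 0 k with hk | hk
  · calc _ ≤ (Finset.Ico (n - k.natAbs) n).card := by
          refine Finset.card_le_card fun i hi => ?_
          simp only [Finset.mem_filter, Finset.mem_range, Finset.mem_Ico] at hi ⊢
          omega
      _ ≤ _ := by simp only [Nat.card_Ico]; omega
  · calc _ ≤ (Finset.range k.natAbs).card := by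
          refine Finset.card_le_card fun i hi => ?_
          simp only [Finset.mem_filter, Finset.mem_range] at hi ⊢
          omega
      _ ≤ _ := by simp

lemma sum_shift_in (n : ℕ) (k : ℤ) (a : ℤ → ℝ) (ha : ∀ l, 0 ≤ a l) :
    (∑ i ∈ Finset.range n, if (0 ≤ (i : ℤ) + k ∧ (i : ℤ) + k < n) then a (i + k) else 0)
      ≤ ∑ l ∈ Finset.range n, a l := by
  rw [← Finset.sum_filter]
  have h1 : ∀ i ∈ (Finset.range n).filter fun i : ℕ => (0 ≤ (i : ℤ) + k ∧ (i : ℤ) + k < n),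
      a (i + k) = a ((((i : ℤ) + k).toNat : ℕ) : ℤ) := by
    intro i hi
    rw [Finset.mem_filter] at hi
    rw [Int.toNat_of_nonneg hi.2.1]
  rw [Finset.sum_congr rfl h1, ← Finset.sum_image (g := fun i : ℕ => ((i : ℤ) + k).toNat)
    (f := fun l : ℕ => a l)]
  · refine Finset.sum_le_sum_of_subset_of_nonneg ?_ (fun _ _ _ => ha _)
    intro l hl
    simp only [Finset.mem_image, Finset.mem_filter, Finset.mem_range] at hl ⊢
    obtain ⟨i, hi, rfl⟩ := hl
    omega
  · intro i hi j hj hij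
    simp only [Finset.coe_filter, Finset.mem_range, mem_ofPred_eq] at hi hj hij
    omega

open scoped Classical in
/-- Number of visits to `B`. -/
noncomputable def visits (T : Equiv.Perm X) (B : Set X) (n : ℕ) (x : X) : ℕ :=
  ((Finset.range n).filter fun i => (T ^ i) x ∈ B).card

lemma visits_eq (T : Equiv.Perm X) (B : Set X) (n : ℕ) (x : X) :
    (visits T B n x : ℝ) = ∑ i ∈ Finset.range n, B.indicator (fun _ => (1 : ℝ)) ((T ^ i) x) := by
  classical
  rw [visits, Finset.card_filter]
  push_cast
  refine Finset.sum_congr rfl fun i _ => ?_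
  simp only [indicator_apply]

lemma hamming_le {T : Equiv.Perm X} {ρ : X → X → ℝ} (hρ : IsSemimetric ρ) {m : ℕ}
    {ξ : X → Fin m} {B : Set X} {C : ℝ} (hC : 0 ≤ C) {F : Finset ℤ}
    (h : ∀ x y, x ∉ B → y ∉ B → ξ x ≠ ξ y → 1 ≤ C * ∑ k ∈ F, ρ ((T ^ k) x) ((T ^ k) y))
    (n : ℕ) (x y : X) :
    ((Finset.univ.filter fun i => nameMap T ξ n x i ≠ nameMap T ξ n y i).card : ℝ) ≤
      (∑ k ∈ F, (k.natAbs : ℝ)) + visits T B n x + visits T B n y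
        + C * (F.card * ∑ l ∈ Finset.range n, ρ ((T ^ l) x) ((T ^ l) y)) := by
  classical
  let a : ℤ → ℝ := fun l => ρ ((T ^ l) x) ((T ^ l) y)
  have ha : ∀ l, 0 ≤ a l := fun l => hρ.nonneg _ _
  have hstep : ∀ i ∈ Finset.range n,
      (if ξ ((T ^ i) x) ≠ ξ ((T ^ i) y) then (1 : ℝ) else 0) ≤
        (∑ k ∈ F, if (0 ≤ (i : ℤ) + k ∧ (i : ℤ) + k < n) then (0 : ℝ) else 1)
        + B.indicator (fun _ => (1 : ℝ)) ((T ^ i) x) + B.indicator (fun _ => (1 : ℝ)) ((T ^ i) y)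
        + C * ∑ k ∈ F, if (0 ≤ (i : ℤ) + k ∧ (i : ℤ) + k < n) then a (i + k) else 0 := by
    intro i _
    have e1 : 0 ≤ ∑ k ∈ F, if (0 ≤ (i : ℤ) + k ∧ (i : ℤ) + k < n) then (0 : ℝ) else 1 :=
      Finset.sum_nonneg fun k _ => by split_ifs <;> norm_num
    have e2 : 0 ≤ B.indicator (fun _ => (1 : ℝ)) ((T ^ i) x) :=
      indicator_nonneg (fun _ _ => zero_le_one) _
    have e3 : 0 ≤ B.indicator (fun _ => (1 : ℝ)) ((T ^ i) y) :=
      indicator_nonneg (fun _ _ => zero_le_one) _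
    have e4 : 0 ≤ C * ∑ k ∈ F, if (0 ≤ (i : ℤ) + k ∧ (i : ℤ) + k < n) then a (i + k) else 0 :=
      mul_nonneg hC (Finset.sum_nonneg fun k _ => by split_ifs; exacts [ha _, le_rfl])
    split_ifs with hne
    swap
    · linarith
    by_cases hxB : (T ^ i) x ∈ B
    · rw [indicator_of_mem hxB]; linarith
    by_cases hyB : (T ^ i) y ∈ B
    · rw [indicator_of_mem hyB]; linarith
    by_cases hF : ∀ k ∈ F, (0 ≤ (i : ℤ) + k ∧ (i : ℤ) + k < n)
    · have h1 := h _ _ hxB hyB hne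
      have h2 : ∑ k ∈ F, ρ ((T ^ k) ((T ^ i) x)) ((T ^ k) ((T ^ i) y)) =
          ∑ k ∈ F, if (0 ≤ (i : ℤ) + k ∧ (i : ℤ) + k < n) then a (i + k) else 0 := by
        refine Finset.sum_congr rfl fun k hk => ?_
        rw [if_pos (hF k hk)]
        simp only [a]
        rw [← zpow_natCast T i, ← Equiv.Perm.mul_apply, ← Equiv.Perm.mul_apply, ← zpow_add,
          add_comm]
      rw [h2] at h1
      linarith
    · push Not at hF
      obtain ⟨k, hk, hk2⟩ := hF
      have h1 : (1 : ℝ) ≤ ∑ k ∈ F, if (0 ≤ (i : ℤ) + k ∧ (i : ℤ) + k < n) then (0 : ℝ) else 1 := by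
        refine le_trans ?_ (Finset.single_le_sum (f := fun k : ℤ =>
          if (0 ≤ (i : ℤ) + k ∧ (i : ℤ) + k < n) then (0 : ℝ) else 1)
          (fun k _ => by split_ifs <;> norm_num) hk)
        rw [if_neg (by rintro ⟨h1, h2⟩; exact absurd (hk2 h1) (not_le.2 h2))]
      linarith
  have hsum := Finset.sum_le_sum hstep
  rw [Finset.sum_add_distrib, Finset.sum_add_distrib, Finset.sum_add_distrib, ← visits_eq,
    ← visits_eq, ← Finset.mul_sum, Finset.sum_comm, Finset.sum_comm (t := F)] at hsum
  have hcard : ((Finset.univ.filter fun i => nameMap T ξ n x i ≠ nameMap T ξ n y i).card : ℝ) =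
      ∑ i ∈ Finset.range n, (if ξ ((T ^ i) x) ≠ ξ ((T ^ i) y) then (1 : ℝ) else 0) := by
    rw [Finset.card_filter]
    simp only [Nat.cast_sum, Nat.cast_ite, Nat.cast_one, Nat.cast_zero]
    rw [← Fin.sum_univ_eq_sum_range
      (fun i => if ξ ((T ^ i) x) ≠ ξ ((T ^ i) y) then (1 : ℝ) else 0)]
    rfl
  rw [hcard]
  refine hsum.trans ?_
  have g1 := Finset.sum_le_sum fun k (_ : k ∈ F) => card_shift_out n k
  have g2 := Finset.sum_le_sum fun k (_ : k ∈ F) => sum_shift_in n k a ha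
  rw [Finset.sum_const, nsmul_eq_mul] at g2
  have g3 := mul_le_mul_of_nonneg_left g2 hC
  have g4 : ∑ l ∈ Finset.range n, a (l : ℤ) = ∑ l ∈ Finset.range n, ρ ((T ^ l) x) ((T ^ l) y) := by
    refine Finset.sum_congr rfl fun l _ => ?_
    simp only [a, zpow_natCast]
  rw [g4] at g3
  linarith

lemma log_card_bound {μ : Measure X} [IsProbabilityMeasure μ] {T : Equiv.Perm X}
    (hT : MeasurePreserving (⇑T) μ μ) {ρ : X → X → ℝ} (hρ : IsSemimetric ρ) {m : ℕ}
    {ξ : X → Fin m} (hξ : Measurable ξ) {B : Set X} (hB : MeasurableSet B)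
    {C : ℝ} (hC : 0 ≤ C) {F : Finset ℤ}
    (h : ∀ x y, x ∉ B → y ∉ B → ξ x ≠ ξ y → 1 ≤ C * ∑ k ∈ F, ρ ((T ^ k) x) ((T ^ k) y))
    {n k : ℕ} (hn : 0 < n) {ε : ℝ} (hε : 0 < ε) (hε1 : ε ≤ 1)
    (hP : IsEntropyPartition μ (avgSemimetric T ρ n) ε k) {t : ℝ} (ht : 0 < t) (ht1 : t ≤ 1) :
    natEnt μ (nameMap T ξ n) ≤ Real.log k + n * (m * t) + (-Real.log t) *
      ((∑ k ∈ F, (k.natAbs : ℝ)) + 2 * (n * μ.real B) + C * (F.card * (n * ε)) + n * ε) := by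
  obtain ⟨P, hPm, -, hPu, hP0, hPd⟩ := hP
  have hn' : (0 : ℝ) < n := by exact_mod_cast hn
  have hk : 0 < k := by
    rcases Nat.eq_zero_or_pos k with rfl | hk
    · exfalso
      have hu : P 0 = univ := by
        rw [← hPu]
        refine Subset.antisymm (subset_iUnion P 0) (iUnion_subset fun j => ?_)
        rw [Fin.fin_one_eq_zero j]
      rw [hu, measure_univ] at hP0
      have : ENNReal.ofReal ε ≤ 1 := by simpa using hε1
      exact absurd hP0 (not_lt.2 this)
    · exact hk
  obtain ⟨x₀⟩ : Nonempty X := μ.nonempty_of_neZero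
  have hrep : ∀ j, ∃ y : X, (P j).Nonempty → y ∈ P j ∧
      ∀ x ∈ P j, visits T B n y ≤ visits T B n x := by
    intro j
    by_cases hne : (P j).Nonempty
    · obtain ⟨y, hy, hy2⟩ := Nat.sInf_mem (hne.image (visits T B n))
      refine ⟨y, fun _ => ⟨hy, fun x hx => ?_⟩⟩
      rw [hy2]
      exact Nat.sInf_le ⟨x, hx, rfl⟩
    · exact ⟨x₀, fun h => absurd h hne⟩
  choose y hy using hrep
  let L : ℝ := ∑ k ∈ F, (k.natAbs : ℝ)
  have hL : 0 ≤ L := Finset.sum_nonneg fun _ _ => Nat.cast_nonneg _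
  let g : X → ℝ := fun x => L + 2 * visits T B n x + C * (F.card * (n * ε))
    + n * (P 0).indicator (fun _ => (1 : ℝ)) x
  have hvi : Integrable (fun x => (visits T B n x : ℝ)) μ := by
    simp only [visits_eq]
    refine integrable_finsetSum _ fun i _ => ?_
    exact (mp_perm_pow hT i).integrable_comp_of_integrable
      ((integrable_const (1 : ℝ)).indicator hB)
  have hvint : ∫ x, (visits T B n x : ℝ) ∂μ = n * μ.real B := by
    simp only [visits_eq]
    have hii : ∀ i ∈ Finset.range n,
        Integrable (fun x => B.indicator (fun _ => (1 : ℝ)) ((T ^ i) x)) μ := fun i _ =>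
      (mp_perm_pow hT i).integrable_comp_of_integrable ((integrable_const (1 : ℝ)).indicator hB)
    rw [integral_finsetSum _ hii]
    have : ∀ i ∈ Finset.range n,
        ∫ x, B.indicator (fun _ => (1 : ℝ)) ((T ^ i) x) ∂μ = μ.real B := by
      intro i _
      have hmeas : AEStronglyMeasurable (B.indicator (fun _ => (1 : ℝ))) (μ.map (⇑(T ^ i))) :=
        (measurable_const.indicator hB).aestronglyMeasurable
      rw [← integral_map (mp_perm_pow hT i).measurable.aemeasurable hmeas,
        (mp_perm_pow hT i).map_eq, integral_indicator hB]
      simp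
    rw [Finset.sum_congr rfl this]
    simp
  have hPi : Integrable ((P 0).indicator (fun _ => (1 : ℝ))) μ :=
    (integrable_const (1 : ℝ)).indicator (hPm 0)
  have hg : Integrable g μ :=
    (((integrable_const L).add (hvi.const_mul 2)).add (integrable_const _)).add (hPi.const_mul _)
  have hgint : ∫ x, g x ∂μ = L + 2 * (n * μ.real B) + C * (F.card * (n * ε))
      + n * μ.real (P 0) := by
    have i1 : Integrable (fun x => L + 2 * (visits T B n x : ℝ)) μ :=
      (integrable_const L).add (hvi.const_mul 2)
    have i2 : Integrable (fun x => L + 2 * (visits T B n x : ℝ) + C * (F.card * (n * ε))) μ :=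
      i1.add (integrable_const _)
    simp only [g]
    rw [integral_add i2 (hPi.const_mul _), integral_add i1
      (integrable_const _), integral_add (integrable_const L) (hvi.const_mul 2),
      integral_const_mul, integral_const_mul _ ((P 0).indicator _), hvint,
      integral_indicator (hPm 0)]
    simp
  have hP0' : μ.real (P 0) ≤ ε := by
    have := ENNReal.toReal_mono ENNReal.ofReal_ne_top hP0.le
    rwa [ENNReal.toReal_ofReal hε.le] at this
  have hmain := natEnt_le_code (μ := μ) (nameMap T ξ n) (measurable_nameMap hT.measurable hξ n)
    (fun j : Fin k => nameMap T ξ n (y j.succ)) hk t ht ht1 g hg ?_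
  · refine hmain.trans ?_
    have hlogt : 0 ≤ -Real.log t := by
      have := Real.log_nonpos ht.le ht1
      linarith
    rw [hgint]
    have := mul_le_mul_of_nonneg_left hP0' hn'.le
    gcongr
  · intro x
    have hx : x ∈ ⋃ j, P j := by rw [hPu]; trivial
    obtain ⟨j, hj⟩ := mem_iUnion.1 hx
    have e1 : 0 ≤ C * (F.card * (n * ε)) := by positivity
    rcases Fin.eq_zero_or_eq_succ j with rfl | ⟨j, rfl⟩
    · refine ⟨⟨0, hk⟩, ?_⟩
      have h1 : ((Finset.univ.filter fun i => nameMap T ξ n x i ≠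
          nameMap T ξ n (y (Fin.succ ⟨0, hk⟩)) i).card : ℝ) ≤ n := by
        have := Finset.card_filter_le (Finset.univ : Finset (Fin n)) fun i => nameMap T ξ n x i ≠
          nameMap T ξ n (y (Fin.succ ⟨0, hk⟩)) i
        simp only [Finset.card_univ, Fintype.card_fin] at this
        exact_mod_cast this
      refine h1.trans ?_
      have e2 : (0 : ℝ) ≤ visits T B n x := Nat.cast_nonneg _
      simp only [g, indicator_of_mem hj]
      linarith
    · refine ⟨j, (hamming_le hρ hC h n x (y j.succ)).trans ?_⟩
      obtain ⟨hy1, hy2⟩ := hy j.succ ⟨x, hj⟩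
      have h1 : (visits T B n (y j.succ) : ℝ) ≤ visits T B n x := by exact_mod_cast hy2 x hj
      have h2 := hPd j.succ (Fin.succ_ne_zero j) x hj _ hy1
      rw [avgSemimetric, div_lt_iff₀ hn'] at h2
      have h3 : C * (F.card * ∑ l ∈ Finset.range n, ρ ((T ^ l) x) ((T ^ l) (y j.succ))) ≤
          C * (F.card * (n * ε)) := by
        rw [mul_comm (n : ℝ) ε]
        gcongr
      have e2 : 0 ≤ (n : ℝ) * (P 0).indicator (fun _ => (1 : ℝ)) x :=
        mul_nonneg hn'.le (indicator_nonneg (fun _ _ => zero_le_one) _)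
      simp only [g, L]
      linarith

/-- Linear lower bound for the `ε`-entropies of averages. -/
lemma linear_lower_bound [StandardBorelSpace X] {μ : Measure X} [IsProbabilityMeasure μ]
    {T : Equiv.Perm X} {ρ : X → X → ℝ}
    (hρ : IsSemimetric ρ) (hm : Measurable (fun p : X × X => ρ p.1 p.2))
    (hTs : Measurable (⇑T.symm)) (hmp : MeasurePreserving (⇑T) μ μ)
    (hadm : IsAdmissible μ ρ) (hgen : IsGenerating μ T ρ) (hpos : 0 < kolmogorovEntropy μ T) :
    ∃ ε : ℝ, 0 < ε ∧ ∃ c : ℝ, 0 < c ∧ ∀ᶠ n : ℕ in atTop,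
      ENNReal.ofReal (c * n) ≤ epsEntropy μ (avgSemimetric T ρ n) ε := by
  obtain ⟨m, ξ, c, hξ, hc, hent⟩ := exists_partition hmp hTs hpos
  obtain ⟨t, ht, ht1, htm⟩ : ∃ t : ℝ, 0 < t ∧ t ≤ 1 ∧ m * t ≤ c / 8 := by
    refine ⟨min 1 (c / 8 / (m + 1)), lt_min one_pos (by positivity), min_le_left _ _, ?_⟩
    calc m * min 1 (c / 8 / (m + 1)) ≤ (m + 1) * (c / 8 / ((m : ℝ) + 1)) := by
          gcongr
          · linarith
          · exact min_le_right _ _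
      _ = c / 8 := by field_simp
  have hlogt : 0 ≤ -Real.log t := by
    have := Real.log_nonpos ht.le ht1
    linarith
  set Λ := -Real.log t with hΛ
  let δ : ℝ := c / 16 / (Λ + 1)
  have hδ : 0 < δ := by positivity
  obtain ⟨B, hB, hBδ, C, hC, F, h⟩ := good_partition hρ hm hmp.measurable hTs hmp hadm hgen ξ
    (fun i => hξ (measurableSet_singleton i)) (ENNReal.ofReal δ) (ENNReal.ofReal_pos.2 hδ)
  have hBδ' : μ.real B ≤ δ := by
    have := ENNReal.toReal_mono ENNReal.ofReal_ne_top hBδ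
    rwa [ENNReal.toReal_ofReal hδ.le] at this
  let ε : ℝ := min 1 (c / 8 / ((Λ + 1) * (C * F.card + 1)))
  have hCF : 0 < (Λ + 1) * (C * F.card + 1) := by positivity
  have hε : 0 < ε := lt_min one_pos (by positivity)
  have hε1 : ε ≤ 1 := min_le_left _ _
  have hε2 : Λ * ((C * F.card + 1) * ε) ≤ c / 8 := by
    calc Λ * ((C * F.card + 1) * ε)
        ≤ (Λ + 1) * ((C * F.card + 1) * (c / 8 / ((Λ + 1) * (C * F.card + 1)))) := by
          have : ε ≤ c / 8 / ((Λ + 1) * (C * F.card + 1)) := min_le_right _ _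
          have h0 : 0 ≤ C * F.card + 1 := by positivity
          have := mul_le_mul_of_nonneg_left this h0
          have h1 : 0 ≤ (C * F.card + 1) * ε := mul_nonneg h0 hε.le
          exact mul_le_mul (by linarith) this h1 (by linarith)
      _ = c / 8 := by field_simp
  have hδ2 : Λ * (2 * μ.real B) ≤ c / 8 := by
    calc Λ * (2 * μ.real B) ≤ (Λ + 1) * (2 * δ) := by
          gcongr
          linarith
      _ = c / 8 := by simp only [δ]; field_simp; norm_num
  let L : ℝ := ∑ k ∈ F, (k.natAbs : ℝ)
  have hlog2 : 0 < Real.log 2 := Real.log_pos one_lt_two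
  refine ⟨ε, hε, c / 2 / Real.log 2, by positivity, ?_⟩
  filter_upwards [eventually_gt_atTop 0, eventually_ge_atTop ⌈Λ * L / (c / 8)⌉₊] with n hn hnL
  have hn' : (0 : ℝ) < n := by exact_mod_cast hn
  have hnL' : Λ * L ≤ n * (c / 8) := by
    have := (Nat.ceil_le.1 hnL)
    rwa [div_le_iff₀ (by positivity)] at this
  classical
  rw [epsEntropy]
  split_ifs with hex
  swap
  · exact le_top
  refine ENNReal.ofReal_le_ofReal ?_
  have hb := log_card_bound hmp hρ hξ hB hC h hn hε hε1 (Nat.find_spec hex) ht ht1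
  have he := hent n
  rw [← hΛ] at hb
  rw [Real.logb, div_mul_eq_mul_div]
  refine div_le_div_of_nonneg_right ?_ hlog2.le
  have k1 := mul_le_mul_of_nonneg_left htm hn'.le
  have k2 := mul_le_mul_of_nonneg_left hδ2 hn'.le
  have k3 := mul_le_mul_of_nonneg_left hε2 hn'.le
  have k4 : Λ * ((∑ k ∈ F, (k.natAbs : ℝ)) + 2 * (n * μ.real B) + C * (F.card * (n * ε)) + n * ε)
      = Λ * L + n * (Λ * (2 * μ.real B)) + n * (Λ * ((C * F.card + 1) * ε)) := by
    simp only [L]; ring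
  rw [k4] at hb
  linarith

/-- If the Kolmogorov entropy of an ergodic automorphism is positive (possibly
infinite) and `h` is a scaling entropy sequence, then `liminf_n h_n/n > 0`. -/
theorem liminf_scalingEntropySeq_div_pos_of_kolmogorovEntropy_pos
    {X : Type*} [MeasurableSpace X] [StandardBorelSpace X]
    (μ : Measure X) [IsProbabilityMeasure μ]
    (T : Equiv.Perm X) (hT : Measurable (⇑T)) (hTsymm : Measurable (⇑T.symm))
    (hTerg : Ergodic (⇑T) μ)
    (hpos : 0 < kolmogorovEntropy μ T)
    (h : ℕ → ℝ) (hh : IsScalingEntropySeq μ T h) :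
    0 < Filter.liminf (fun n : ℕ => ENNReal.ofReal (h n / n)) Filter.atTop := by
  obtain ⟨ρ, hρ, hm, -, hadm, hgen, hhpos, hsup, -⟩ := hh
  obtain ⟨ε, hε, c, hc, hlow⟩ := linear_lower_bound hρ hm hTsymm hTerg.toMeasurePreserving
    hadm hgen hpos
  obtain ⟨K, hK1, hK2⟩ := exists_between (hsup ε hε)
  have hev := eventually_lt_of_limsup_lt hK1
  have hKr : 0 < K.toReal + 1 := by positivity
  refine lt_of_lt_of_le (ENNReal.ofReal_pos.2 (div_pos hc hKr))
    (le_liminf_of_le (by isBoundedDefault) ?_)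
  filter_upwards [hev, hlow, eventually_ge_atTop 1] with n h1 h2 hn
  have hn' : (0 : ℝ) < n := by exact_mod_cast hn
  have hhn := hhpos n hn
  refine ENNReal.ofReal_le_ofReal ?_
  rw [ENNReal.div_lt_iff (Or.inl (ENNReal.ofReal_pos.2 hhn).ne') (Or.inl ENNReal.ofReal_ne_top)]
    at h1
  have h3 := ENNReal.toReal_mono (ENNReal.mul_ne_top hK2.ne ENNReal.ofReal_ne_top)
    (h2.trans h1.le)
  rw [ENNReal.toReal_mul, ENNReal.toReal_ofReal hhn.le, ENNReal.toReal_ofReal (by positivity)]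
    at h3
  rw [div_le_div_iff₀ hKr hn']
  linarith
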